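/- Let p be a transition kernel on a finite MDP whose state space contains a distinguished state z that is absorbing under p (p_{z,a} = 1_z for every action a). Then for every stationary policy π, every state-action pair (s,a) with s ≠ z and π(s) = a, and every horizon d ≥ 1: (1 − W_d^π(1_z, p, 1_s)) · W_d^π(1_{s,a}, cut(p), 1_s) ≤ W_d^π(1_{s,a}, p, 1_s) ≤ W_d^π(1_{s,a}, cut(p), 1_s). -/

import Mathlib

open scoped Classical BigOperators

/-- `valS p r π d s` is the expected total reward `E[Σ_{h=1}^d r(s_h,a_h)]` collected in `d`
steps following the stationary policy `π` under the transition kernel `p`, starting from `s`. -/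
noncomputable def valS {S A : Type*} [Fintype S] (p : S → A → S → ℝ)
    (r : S → A → ℝ) (π : S → A) : ℕ → S → ℝ
  | 0, _ => 0
  | d + 1, s => r s (π s) + ∑ s' : S, p s (π s) s' * valS p r π d s'

/-- The `cut` transition model: for `(s,a)` with `p_{s,a,z} < 1`, renormalize the row away
from `z`; for `(s,a)` with `p_{s,a,z} = 1`, keep the Dirac row at `z`. -/
noncomputable def cutKer {S A : Type*} (p : S → A → S → ℝ) (z : S) : S → A → S → ℝ :=
  fun s a s' =>
    if p s a z = 1 then (if s' = z then 1 else 0)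
    else if s' = z then 0 else p s a s' / (1 - p s a z)

/-- The indicator reward `1_{s,a}`. -/
noncomputable def ind {S A : Type*} (s : S) (a : A) : S → A → ℝ :=
  fun s' a' => if s' = s ∧ a' = a then 1 else 0

/-- The reward `1_z` equal to `1` exactly on the state `z`. -/
noncomputable def indState {S A : Type*} (z : S) : S → A → ℝ :=
  fun s' _ => if s' = z then 1 else 0

lemma ind_nonneg {S A : Type*} (s : S) (a : A) (x : S) (b : A) : 0 ≤ ind s a x b := by
  unfold ind; split_ifs <;> norm_num

lemma indState_nonneg {S A : Type*} (z x : S) (b : A) : 0 ≤ indState z x b := by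
  unfold indState; split_ifs <;> norm_num

lemma cutKer_absorbing {S A : Type*} {p : S → A → S → ℝ} {z : S}
    (habs : ∀ a s', p z a s' = if s' = z then 1 else 0)
    (a : A) (y : S) : cutKer p z z a y = if y = z then 1 else 0 := by
  simp [cutKer, habs]

section StochasticKernel

variable {S A : Type*} [Fintype S]

lemma valS_nonneg {p : S → A → S → ℝ} {r : S → A → ℝ} (hp0 : ∀ s a s', 0 ≤ p s a s')
    (hr : ∀ s a, 0 ≤ r s a) (π : S → A) (d : ℕ) (x : S) : 0 ≤ valS p r π d x := by
  induction d generalizing x with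
  | zero => simp [valS]
  | succ d ih =>
    exact add_nonneg (hr _ _) (Finset.sum_nonneg fun y _ => mul_nonneg (hp0 _ _ _) (ih y))

lemma valS_le_succ {p : S → A → S → ℝ} {r : S → A → ℝ} (hp0 : ∀ s a s', 0 ≤ p s a s')
    (hr : ∀ s a, 0 ≤ r s a) (π : S → A) (d : ℕ) (x : S) :
    valS p r π d x ≤ valS p r π (d + 1) x := by
  induction d generalizing x with
  | zero => exact valS_nonneg hp0 hr π 1 x
  | succ d ih =>
    exact add_le_add_right
      (Finset.sum_le_sum fun y _ => mul_le_mul_of_nonneg_left (ih y) (hp0 _ _ _)) _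

lemma valS_mono {p : S → A → S → ℝ} {r : S → A → ℝ} (hp0 : ∀ s a s', 0 ≤ p s a s')
    (hr : ∀ s a, 0 ≤ r s a) (π : S → A) (x : S) : Monotone fun d => valS p r π d x :=
  monotone_nat_of_le_succ fun d => valS_le_succ hp0 hr π d x

/-- The expected number of visits to `(s, a)` is largest when starting from `s`. -/
lemma valS_ind_le_valS_ind_self {p : S → A → S → ℝ} (hp0 : ∀ s a s', 0 ≤ p s a s')
    (hp1 : ∀ s a, ∑ s' : S, p s a s' = 1) (π : S → A) (s : S) (a : A) {n d : ℕ} (hnd : n ≤ d)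
    (x : S) : valS p (ind s a) π n x ≤ valS p (ind s a) π d s := by
  induction n generalizing x with
  | zero => exact valS_nonneg hp0 (ind_nonneg s a) π d s
  | succ n ih =>
    by_cases hx : x = s
    · subst hx
      exact valS_mono hp0 (ind_nonneg x a) π x hnd
    · have hr : ind s a x (π x) = 0 := by simp [ind, hx]
      calc valS p (ind s a) π (n + 1) x
          = ∑ y, p x (π x) y * valS p (ind s a) π n y := by simp [valS, hr]
        _ ≤ ∑ y, p x (π x) y * valS p (ind s a) π d s :=
            Finset.sum_le_sum fun y _ =>
              mul_le_mul_of_nonneg_left (ih (Nat.le_of_succ_le hnd) y) (hp0 _ _ _)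
        _ = valS p (ind s a) π d s := by rw [← Finset.sum_mul, hp1, one_mul]

lemma valS_succ_of_absorbing {p : S → A → S → ℝ} {z : S}
    (habs : ∀ a s', p z a s' = if s' = z then 1 else 0) (r : S → A → ℝ) (π : S → A) (d : ℕ) :
    valS p r π (d + 1) z = r z (π z) + valS p r π d z := by
  simp [valS, habs]

lemma valS_ind_eq_zero_of_absorbing {p : S → A → S → ℝ} {z : S}
    (habs : ∀ a s', p z a s' = if s' = z then 1 else 0) {s : S} (hs : s ≠ z) (a : A)
    (π : S → A) (d : ℕ) : valS p (ind s a) π d z = 0 := by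
  induction d with
  | zero => rfl
  | succ d ih => rw [valS_succ_of_absorbing habs, ih]; simp [ind, hs.symm]

lemma valS_indState_of_absorbing {p : S → A → S → ℝ} {z : S}
    (habs : ∀ a s', p z a s' = if s' = z then 1 else 0) (π : S → A) (d : ℕ) :
    valS p (indState z) π d z = d := by
  induction d with
  | zero => simp [valS]
  | succ d ih => rw [valS_succ_of_absorbing habs, ih]; simp [indState, add_comm]

lemma valS_ind_le_of_le_off {p q : S → A → S → ℝ} {z : S} (hp0 : ∀ s a s', 0 ≤ p s a s')
    (hq0 : ∀ s a s', 0 ≤ q s a s') (habs : ∀ a s', p z a s' = if s' = z then 1 else 0)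
    (hpq : ∀ x a y, y ≠ z → p x a y ≤ q x a y) {s : S} (hs : s ≠ z) (a : A) (π : S → A)
    (d : ℕ) (x : S) : valS p (ind s a) π d x ≤ valS q (ind s a) π d x := by
  induction d generalizing x with
  | zero => exact le_rfl
  | succ d ih =>
    refine add_le_add_right (Finset.sum_le_sum fun y _ => ?_) _
    by_cases hy : y = z
    · rw [hy, valS_ind_eq_zero_of_absorbing habs hs, mul_zero]
      exact mul_nonneg (hq0 _ _ _) (valS_nonneg hq0 (ind_nonneg s a) π d z)
    · exact mul_le_mul (hpq _ _ _ hy) (ih y) (valS_nonneg hp0 (ind_nonneg s a) π d y)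
        (hq0 _ _ _)

/-- If `q` dominates `p` away from the common absorbing state `z`, the loss in expected visits
to `(s, a)` under `p` is controlled by the expected time `p` spends in `z`. -/
lemma valS_ind_le_add_of_le_off {p q : S → A → S → ℝ} {z : S} (hp0 : ∀ s a s', 0 ≤ p s a s')
    (hp1 : ∀ s a, ∑ s' : S, p s a s' = 1) (hq0 : ∀ s a s', 0 ≤ q s a s')
    (hq1 : ∀ s a, ∑ s' : S, q s a s' = 1)
    (habs : ∀ a s', p z a s' = if s' = z then 1 else 0)
    (habs' : ∀ a s', q z a s' = if s' = z then 1 else 0)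
    (hpq : ∀ x a y, y ≠ z → p x a y ≤ q x a y) {s : S} (hs : s ≠ z) (a : A) (π : S → A)
    {n d : ℕ} (hnd : n ≤ d) (x : S) :
    valS q (ind s a) π n x ≤ valS p (ind s a) π n x
      + valS p (indState z) π n x * valS q (ind s a) π d s := by
  induction n generalizing x with
  | zero => simp [valS]
  | succ n ih =>
    have hn : n ≤ d := Nat.le_of_succ_le hnd
    set M := valS q (ind s a) π d s with hM
    have hM0 : 0 ≤ M := valS_nonneg hq0 (ind_nonneg s a) π d s
    have hbound (y : S) : valS q (ind s a) π n y ≤ n * M := by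
      rcases Nat.eq_zero_or_pos n with rfl | hpos
      · simp [valS]
      · have h1 : (1 : ℝ) ≤ n := by exact_mod_cast hpos
        exact (valS_ind_le_valS_ind_self hq0 hq1 π s a hn y).trans
          (le_mul_of_one_le_left hM0 h1)
    have hterm (y : S) : q x (π x) y * valS q (ind s a) π n y ≤
        p x (π x) y * valS p (ind s a) π n y + p x (π x) y * valS p (indState z) π n y * M
          + (q x (π x) y - p x (π x) y) * (n * M) := by
      by_cases hy : y = z
      · subst hy
        rw [valS_ind_eq_zero_of_absorbing habs hs, valS_ind_eq_zero_of_absorbing habs' hs,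
          valS_indState_of_absorbing habs]
        have := mul_nonneg (hq0 x (π x) y) (mul_nonneg n.cast_nonneg hM0)
        linarith
      · have h1 := mul_le_mul_of_nonneg_left (ih hn y) (hp0 x (π x) y)
        have h2 := mul_le_mul_of_nonneg_left (hbound y) (sub_nonneg.2 (hpq x (π x) y hy))
        linarith
    have hsum := Finset.sum_le_sum fun y (_ : y ∈ Finset.univ) => hterm y
    rw [Finset.sum_add_distrib, Finset.sum_add_distrib, ← Finset.sum_mul, ← Finset.sum_mul,
      Finset.sum_sub_distrib, hq1, hp1, sub_self, zero_mul, add_zero] at hsum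
    have hr := mul_nonneg (indState_nonneg z x (π x)) hM0
    simp only [valS]
    linarith

end StochasticKernel

section CutKernel

variable {S A : Type*} [Fintype S] {p : S → A → S → ℝ}

lemma kernel_le_one (hp0 : ∀ s a s', 0 ≤ p s a s') (hp1 : ∀ s a, ∑ s' : S, p s a s' = 1)
    (x : S) (a : A) (y : S) : p x a y ≤ 1 :=
  (Finset.single_le_sum (fun i _ => hp0 x a i) (Finset.mem_univ y)).trans_eq (hp1 x a)

lemma sum_erase_kernel (hp1 : ∀ s a, ∑ s' : S, p s a s' = 1) (x : S) (a : A) (z : S) :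
    ∑ y ∈ Finset.univ.erase z, p x a y = 1 - p x a z := by
  rw [← hp1 x a, ← Finset.sum_erase_add _ _ (Finset.mem_univ z), add_sub_cancel_right]

lemma cutKer_nonneg (hp0 : ∀ s a s', 0 ≤ p s a s') (hp1 : ∀ s a, ∑ s' : S, p s a s' = 1)
    (z x : S) (a : A) (y : S) : 0 ≤ cutKer p z x a y := by
  unfold cutKer
  split_ifs
  · exact zero_le_one
  · exact le_rfl
  · exact le_rfl
  · exact div_nonneg (hp0 _ _ _) (sub_nonneg.2 (kernel_le_one hp0 hp1 x a z))

lemma sum_cutKer (hp1 : ∀ s a, ∑ s' : S, p s a s' = 1) (z x : S) (a : A) :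
    ∑ y : S, cutKer p z x a y = 1 := by
  by_cases h : p x a z = 1
  · simp [cutKer, h]
  · have h' : 1 - p x a z ≠ 0 := sub_ne_zero.2 (Ne.symm h)
    rw [← Finset.sum_erase_add _ _ (Finset.mem_univ z)]
    have hz : cutKer p z x a z = 0 := by simp [cutKer, h]
    have hy : ∀ y ∈ Finset.univ.erase z, cutKer p z x a y = p x a y / (1 - p x a z) :=
      fun y hy => by simp [cutKer, h, Finset.ne_of_mem_erase hy]
    rw [hz, add_zero, Finset.sum_congr rfl hy, ← Finset.sum_div, sum_erase_kernel hp1,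
      div_self h']

lemma le_cutKer (hp0 : ∀ s a s', 0 ≤ p s a s') (hp1 : ∀ s a, ∑ s' : S, p s a s' = 1)
    (z x : S) (a : A) (y : S) (hy : y ≠ z) : p x a y ≤ cutKer p z x a y := by
  by_cases h : p x a z = 1
  · have hle := Finset.single_le_sum (fun i _ => hp0 x a i)
      (Finset.mem_erase.2 ⟨hy, Finset.mem_univ y⟩)
    rw [sum_erase_kernel hp1, h, sub_self] at hle
    simpa [cutKer, h, hy] using hle
  · have hlt : p x a z < 1 := lt_of_le_of_ne (kernel_le_one hp0 hp1 x a z) h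
    have hdiv : p x a y ≤ p x a y / (1 - p x a z) :=
      le_div_self (hp0 x a y) (sub_pos.2 hlt) (sub_le_self 1 (hp0 x a z))
    simpa [cutKer, h, hy] using hdiv

end CutKernel

/-- If `z` is absorbing under `p`, then for every stationary policy `π` with `π(s) = a`
(`s ≠ z`) and every horizon `d ≥ 1`:
`(1 - W_d^π(1_z,p,1_s))·W_d^π(1_{s,a},cut(p),1_s) ≤ W_d^π(1_{s,a},p,1_s)
≤ W_d^π(1_{s,a},cut(p),1_s)`. -/
theorem cut_sandwich {S A : Type*} [Fintype S] [Fintype A]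
    (p : S → A → S → ℝ)
    (hp0 : ∀ s a s', 0 ≤ p s a s') (hp1 : ∀ s a, ∑ s' : S, p s a s' = 1)
    (z : S) (habs : ∀ a s', p z a s' = if s' = z then 1 else 0)
    (π : S → A) (s : S) (a : A) (hs : s ≠ z) (hπ : π s = a) (d : ℕ) (hd : 1 ≤ d) :
    (1 - valS p (indState z) π d s) * valS (cutKer p z) (ind s a) π d s ≤
        valS p (ind s a) π d s ∧
      valS p (ind s a) π d s ≤ valS (cutKer p z) (ind s a) π d s := by
  have hq0 := cutKer_nonneg hp0 hp1 z
  have hpq := le_cutKer hp0 hp1 z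
  refine ⟨?_, valS_ind_le_of_le_off hp0 hq0 habs hpq hs a π d s⟩
  have h := valS_ind_le_add_of_le_off hp0 hp1 hq0 (sum_cutKer hp1 z) habs
    (cutKer_absorbing habs) hpq hs a π (le_refl d) s
  linarith
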